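/- Let (X,Y) and (X',Y') be independent pairs of ℤ-valued random variables, where Y and Y' take values in {0,1} with P(Y=0) = α and P(Y'=0) = β, and H(X|Y) = H(X'|Y') = c < ∞. Then H(X+X' | Y,Y') − c ≥ g(c,c) − min{h₂(α), h₂(β)}, where g(c,d) = (1/2) · min_{(x,y)∈[0,1]²} max( d·x − h₂(x) + c·y − h₂(y) , l(x,y) ), with l(x,y) = min_{(a,b)∈T(x,y)} ((1−x)²a² + (1−y)²b²)/(8 ln 2) and T(x,y) = {(a,b) ∈ ℝ₊² : a ≥ (4y−2)⁺, b ≥ (4x−2)⁺, a+b ≥ 2−x−y}. -/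

import Mathlib

open MeasureTheory ProbabilityTheory

/-- Binary entropy function (in bits), with the convention `0 * log₂ 0 = 0`. -/
noncomputable def H2 (x : ℝ) : ℝ := -(x * Real.logb 2 x) - (1 - x) * Real.logb 2 (1 - x)

/-- The constraint set `T(x,y) = {(a,b) ∈ ℝ₊² : a ≥ (4y−2)⁺, b ≥ (4x−2)⁺, a+b ≥ 2−x−y}`. -/
def Tset (x y : ℝ) : Set (ℝ × ℝ) :=
  {ab | 0 ≤ ab.1 ∧ 0 ≤ ab.2 ∧ max (4 * y - 2) 0 ≤ ab.1 ∧ max (4 * x - 2) 0 ≤ ab.2 ∧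
    2 - x - y ≤ ab.1 + ab.2}

/-- `l(x,y) = min_{(a,b) ∈ T(x,y)} ((1−x)²a² + (1−y)²b²)/(8 ln 2)`. -/
noncomputable def lfun (x y : ℝ) : ℝ :=
  sInf ((fun ab : ℝ × ℝ => ((1 - x) ^ 2 * ab.1 ^ 2 + (1 - y) ^ 2 * ab.2 ^ 2) / (8 * Real.log 2))
    '' Tset x y)

/-- `g(c,d) = (1/2)·min_{(x,y)∈[0,1]²} max( d·x − h₂(x) + c·y − h₂(y) , l(x,y) )`. -/
noncomputable def gNIID (c d : ℝ) : ℝ :=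
  (1 / 2) * sInf ((fun xy : ℝ × ℝ =>
      max (d * xy.1 - H2 xy.1 + c * xy.2 - H2 xy.2) (lfun xy.1 xy.2))
    '' (Set.Icc (0 : ℝ) 1 ×ˢ Set.Icc (0 : ℝ) 1))

/-- Probability of an event, as a real number. -/
noncomputable def pr {Ω : Type*} [MeasurableSpace Ω] (μ : Measure Ω) (A : Set Ω) : ℝ :=
  (μ A).toReal

/-- The `(k, b)`-summand of the conditional entropy `H(X|Y)` (in bits):
`−P(X=k, Y=b)·log₂( P(X=k, Y=b) / P(Y=b) )`. -/
noncomputable def condEntTerm {Ω β : Type*} [MeasurableSpace Ω] (μ : Measure Ω)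
    (X : Ω → ℤ) (Y : Ω → β) (kb : ℤ × β) : ℝ :=
  -(pr μ {ω | X ω = kb.1 ∧ Y ω = kb.2} *
    Real.logb 2 (pr μ {ω | X ω = kb.1 ∧ Y ω = kb.2} / pr μ {ω | Y ω = kb.2}))

/-- Conditional entropy `H(X|Y)` (in bits). -/
noncomputable def condEnt {Ω β : Type*} [MeasurableSpace Ω] (μ : Measure Ω)
    (X : Ω → ℤ) (Y : Ω → β) : ℝ :=
  ∑' kb : ℤ × β, condEntTerm μ X Y kb

/-- `H(X|Y) = c` with a convergent (finite) sum. -/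
def CondEntIs {Ω β : Type*} [MeasurableSpace Ω] (μ : Measure Ω)
    (X : Ω → ℤ) (Y : Ω → β) (c : ℝ) : Prop :=
  HasSum (condEntTerm μ X Y) c

namespace S17
open Real

lemma hoeff (R f : ℝ) (h0 : 0 ≤ R) (h1 : R ≤ 1) :
    (1 - R) * exp (f * (0 - R)) + R * exp (f * (1 - R)) ≤ exp (f ^ 2 / 8) := by
  let ν : MeasureTheory.Measure ℝ := ENNReal.ofReal (1 - R) • MeasureTheory.Measure.dirac 0 +
    ENNReal.ofReal R • MeasureTheory.Measure.dirac 1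
  have hν : MeasureTheory.IsProbabilityMeasure ν := by
    constructor
    simp [ν]
    rw [← ENNReal.ofReal_add (by linarith) h0]; simp
  have hint : ∀ g : ℝ → ℝ, ∫ x, g x ∂ν = (1 - R) * g 0 + R * g 1 := by
    intro g
    rw [MeasureTheory.integral_add_measure]
    · rw [MeasureTheory.integral_smul_measure, MeasureTheory.integral_smul_measure]
      simp [ENNReal.toReal_ofReal, h0, h1]
    · exact (MeasureTheory.integrable_dirac (by simp)).smul_measure (by simp)
    · exact (MeasureTheory.integrable_dirac (by simp)).smul_measure (by simp)
  have := ProbabilityTheory.hasSubgaussianMGF_of_mem_Icc (μ := ν) (X := id) (a := 0) (b := 1)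
    aemeasurable_id (by
      simp only [ν, MeasureTheory.ae_add_measure_iff]
      constructor <;>
      · refine MeasureTheory.Measure.ae_smul_measure ?_ _
        rw [MeasureTheory.ae_dirac_iff (measurableSet_Icc.preimage measurable_id)]; simp)
  have h2 := this.mgf_le f
  simp only [ProbabilityTheory.mgf] at h2
  rw [hint, hint] at h2
  simp at h2
  convert h2 using 2 
  · simp
  · norm_num; ring

structure IsPmf (p : ℤ → ℝ) : Prop where
  nn : ∀ k, 0 ≤ p k
  sum : HasSum p 1
  ent : Summable fun k => negMulLog (p k)

noncomputable def ent (p : ℤ → ℝ) : ℝ := ∑' k, negMulLog (p k)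
noncomputable def conv (p q : ℤ → ℝ) (n : ℤ) : ℝ := ∑' k, p k * q (n - k)

lemma hasSum_mul2 {f g : ℤ → ℝ} {a b : ℝ} (hf : HasSum f a) (hg : HasSum g b) :
    HasSum (fun kl : ℤ × ℤ => f kl.1 * g kl.2) (a * b) :=
  HasSum.mul hf hg (summable_mul_of_summable_norm hf.summable.norm hg.summable.norm)

lemma IsPmf.le_one {p : ℤ → ℝ} (hp : IsPmf p) (k : ℤ) : p k ≤ 1 :=
  le_hasSum hp.sum k (fun j _ => hp.nn j)

lemma summable_fib {p q : ℤ → ℝ} (hp : IsPmf p) (hq : IsPmf q) (n : ℤ) :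
    Summable (fun k => p k * q (n - k)) := by
  refine Summable.of_nonneg_of_le (fun k => mul_nonneg (hp.nn _) (hq.nn _)) (fun k => ?_) hp.sum.summable
  exact mul_le_of_le_one_right (hp.nn _) (hq.le_one _)

lemma conv_fib {p q φ : ℤ → ℝ} (hp : IsPmf p) (hq : IsPmf q) {b : ℝ}
    (h : HasSum (fun kl : ℤ × ℤ => p kl.1 * q kl.2 * φ (kl.1 + kl.2)) b) :
    HasSum (fun n => conv p q n * φ n) b := by
  let e : ℤ × ℤ ≃ ℤ × ℤ :=
    { toFun := fun nk => (nk.2, nk.1 - nk.2)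
      invFun := fun kl => (kl.1 + kl.2, kl.1)
      left_inv := fun x => by simp
      right_inv := fun x => by simp }
  have h' := (e.hasSum_iff (f := fun kl : ℤ × ℤ => p kl.1 * q kl.2 * φ (kl.1 + kl.2))).2 h
  refine h'.prod_fiberwise (fun n => ?_)
  have := ((summable_fib hp hq n).hasSum).mul_right (φ n)
  simpa [e, conv] using this

lemma conv_comm {p q : ℤ → ℝ} : conv p q = conv q p := by
  funext n
  unfold conv
  rw [← (Equiv.subLeft n).tsum_eq]
  refine tsum_congr fun k => ?_
  simp [mul_comm]

lemma conv_sum {p q : ℤ → ℝ} (hp : IsPmf p) (hq : IsPmf q) : HasSum (conv p q) 1 := by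
  have := conv_fib (φ := fun _ => 1) hp hq (by simpa using hasSum_mul2 hp.sum hq.sum)
  simpa using this

lemma conv_nn {p q : ℤ → ℝ} (hp : IsPmf p) (hq : IsPmf q) (n) : 0 ≤ conv p q n :=
  tsum_nonneg fun _ => mul_nonneg (hp.nn _) (hq.nn _)

lemma le_conv {p q : ℤ → ℝ} (hp : IsPmf p) (hq : IsPmf q) (k l : ℤ) :
    p k * q l ≤ conv p q (k + l) := by
  have := (summable_fib hp hq (k + l)).le_tsum k (fun j _ => mul_nonneg (hp.nn _) (hq.nn _))
  simpa [conv] using this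

lemma sum_log {p q : ℤ → ℝ} (hp : IsPmf p) (hq : IsPmf q) :
    Summable (fun kl : ℤ × ℤ => p kl.1 * q kl.2 * (- log (conv p q (kl.1 + kl.2)))) := by
  have h1 := (hasSum_mul2 hp.ent.hasSum hq.sum).add (hasSum_mul2 hp.sum hq.ent.hasSum)
  refine Summable.of_nonneg_of_le (fun kl => ?_) (fun kl => ?_) h1.summable
  · refine mul_nonneg (mul_nonneg (hp.nn _) (hq.nn _)) ?_
    have := log_nonpos (conv_nn hp hq (kl.1 + kl.2))
      (le_hasSum (conv_sum hp hq) _ (fun j _ => conv_nn hp hq j))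
    linarith
  · rcases (hp.nn kl.1).eq_or_lt with h | h
    · simp [← h]
    rcases (hq.nn kl.2).eq_or_lt with h' | h'
    · simp [← h']
    have h3 := log_le_log (mul_pos h h') (le_conv hp hq kl.1 kl.2)
    rw [log_mul h.ne' h'.ne'] at h3
    have := mul_le_mul_of_nonneg_left h3 (mul_pos h h').le
    simp only [negMulLog]
    linarith

lemma conv_ent {p q : ℤ → ℝ} (hp : IsPmf p) (hq : IsPmf q) :
    HasSum (fun kl : ℤ × ℤ => p kl.1 * q kl.2 * (- log (conv p q (kl.1 + kl.2))))
      (ent (conv p q)) ∧ Summable (fun n => negMulLog (conv p q n)) := by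
  have h := conv_fib (φ := fun n => - log (conv p q n)) hp hq (sum_log hp hq).hasSum
  have h2 : (fun n => conv p q n * - log (conv p q n)) = fun n => negMulLog (conv p q n) := by
    funext n; simp [negMulLog]
  rw [h2] at h
  refine ⟨?_, h.summable⟩
  rw [ent, h.tsum_eq]
  exact (sum_log hp hq).hasSum

/-- Gibbs-type bound. -/
lemma gibbs {p q : ℤ → ℝ} (hp : IsPmf p) (hq : IsPmf q) {F g : ℤ × ℤ → ℝ} (w : ℤ × ℤ → ℝ) {a b : ℝ}
    (hw : ∀ k l, 0 < p k → 0 < q l → 0 < w (k, l) ∧ F (k, l) = p k * q l * (- log (w (k, l))) ∧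
      p k * q l * (conv p q (k + l) / w (k, l)) ≤ g (k, l))
    (hF : ∀ k l, p k * q l = 0 → F (k, l) ≤ 0) (hg0 : ∀ kl, 0 ≤ g kl)
    (ha : HasSum F a) (hb : HasSum g b) (hb1 : b ≤ 1) : a ≤ ent (conv p q) := by
  have h1 := (conv_ent hp hq).1
  have h2 : HasSum (fun kl => F kl + p kl.1 * q kl.2 - g kl) (a + 1 * 1 - b) :=
    (ha.add (hasSum_mul2 hp.sum hq.sum)).sub hb
  have h3 := hasSum_le ?_ h2 h1
  · linarith
  rintro ⟨k, l⟩
  rcases (mul_nonneg (hp.nn k) (hq.nn l)).eq_or_lt with h | h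
  · have := hF k l h.symm
    have := hg0 (k, l)
    simp only [← h]; linarith
  have hk : 0 < p k := lt_of_le_of_ne (hp.nn k) (by rintro h'; simp [← h'] at h)
  have hl : 0 < q l := lt_of_le_of_ne (hq.nn l) (by rintro h'; simp [← h'] at h)
  obtain ⟨hw0, hF', hg'⟩ := hw k l hk hl
  have hr : 0 < conv p q (k + l) := h.trans_le (le_conv hp hq k l)
  have h4 := log_le_sub_one_of_pos (div_pos hr hw0)
  rw [log_div hr.ne' hw0.ne'] at h4
  have := mul_le_mul_of_nonneg_left h4 h.le
  simp only [hF']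
  nlinarith

lemma key1 {p q : ℤ → ℝ} (hp : IsPmf p) (hq : IsPmf q) (l0 : ℤ) :
    q l0 * ent p + ent q - negMulLog (q l0) - negMulLog (1 - q l0) ≤ ent (conv p q) := by
  classical
  set y := q l0 with hy
  have hy1 : y ≤ 1 := hq.le_one l0
  have hy0 : 0 ≤ y := hq.nn l0
  -- pieces
  have hs : HasSum (fun l : ℤ => if l = l0 then y else 0) y := hasSum_ite_eq l0 y
  have hs' : HasSum (fun l : ℤ => if l = l0 then negMulLog y else 0) (negMulLog y) :=
    hasSum_ite_eq l0 _
  have ht : HasSum (fun l : ℤ => q l - if l = l0 then y else 0) (1 - y) := hq.sum.sub hs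
  have hA := hasSum_mul2 hp.ent.hasSum hs
  have hB := hasSum_mul2 hp.sum (hq.ent.hasSum.sub hs')
  have hC := (hasSum_mul2 hp.sum ht).mul_right (log (1 - y))
  have hF := (hA.add hB).add hC
  -- g
  let e : ℤ × ℤ ≃ ℤ × ℤ :=
    { toFun := fun kl => (kl.1, kl.1 + kl.2)
      invFun := fun kn => (kn.1, kn.2 - kn.1)
      left_inv := fun x => by simp
      right_inv := fun x => by simp }
  let e2 : ℤ × ℤ ≃ ℤ × ℤ :=
    { toFun := fun kl => (kl.2, kl.1 + kl.2)
      invFun := fun kn => (kn.2 - kn.1, kn.1)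
      left_inv := fun x => by simp
      right_inv := fun x => by simp }
  have hg1 := (e2.hasSum_iff).2 (hasSum_mul2 hs (conv_sum hp hq))
  have hg2 := ((e.hasSum_iff).2 (hasSum_mul2 hp.sum (conv_sum hp hq))).mul_left (1 - y)
  have hg := hg1.add hg2
  have := gibbs hp hq (fun kl => if kl.2 = l0 then p kl.1 else q kl.2 / (1 - y)) ?_ ?_ ?_ hF hg (by linarith)
  · have h5 : ent p * y + 1 * (∑' l, negMulLog (q l) - negMulLog y) + 1 * (1 - y) * log (1 - y)
        = y * ent p + ent q - negMulLog y - negMulLog (1 - y) := by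
      simp only [ent, negMulLog]; ring
    rw [← h5]; exact this
  · intro k l hk hl
    by_cases h : l = l0
    · subst h
      refine ⟨by simpa using hk, ?_, ?_⟩
      · simp [negMulLog, ← hy]; ring
      · have hr : 0 ≤ conv p q (k + l) := conv_nn hp hq _
        simp [e, e2, ← hy]
        have : p k * y * (conv p q (k + l) / p k) = y * conv p q (k + l) := by field_simp
        rw [this]
        have := mul_nonneg (sub_nonneg.2 hy1) (mul_nonneg hk.le hr)
        linarith
    · have hlt : y < 1 := by
        have := sum_le_hasSum {l0, l} (fun j _ => hq.nn j) hq.sum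
        rw [Finset.sum_pair (fun h' => h h'.symm)] at this
        linarith
      have h1y : 0 < 1 - y := by linarith
      refine ⟨by simpa [h] using div_pos hl h1y, ?_, ?_⟩
      · simp [h, negMulLog]
        rw [log_div hl.ne' h1y.ne']; ring
      · simp [e, e2, h]
        apply le_of_eq; field_simp
  · intro k l h
    by_cases h' : l = l0
    · subst h'
      rcases mul_eq_zero.1 h with h | h
      · simp [h]
      · simp [← hy] at h
        simp [← hy, h]
    · rcases mul_eq_zero.1 h with h | h
      · simp [h']; simp [h]
      · simp [h', h]
  · intro kl
    have hr : ∀ n, 0 ≤ conv p q n := conv_nn hp hq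
    refine add_nonneg (mul_nonneg ?_ (hr _)) (mul_nonneg (by linarith) (mul_nonneg (hp.nn _) (hr _)))
    split_ifs <;> simp [hy0]

end S17

namespace S17
open Real

lemma key2 {p q : ℤ → ℝ} (hp : IsPmf p) (hq : IsPmf q) {I W : ℤ → ℝ} {α U R : ℝ}
    (hI : ∀ k, I k = 0 ∨ I k = 1) (hW : ∀ k, W k = 0 ∨ W k = 1)
    (hα : HasSum (fun k => p k * I k) α)
    (hU : HasSum (fun kl : ℤ × ℤ => p kl.1 * q kl.2 * (I kl.1 * W (kl.1 + kl.2))) U)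
    (hR : HasSum (fun kl : ℤ × ℤ => p kl.1 * q kl.2 * W (kl.1 + kl.2)) R) (m : ℝ) :
    ent q + m * (U - α * R) - m ^ 2 * (α * (1 - α)) / 8 ≤ ent (conv p q) := by
  set r := conv p q with hr
  have hRr : HasSum (fun n => r n * W n) R := conv_fib hp hq hR
  have hr0 : ∀ n, 0 ≤ r n := conv_nn hp hq
  have hr1 : HasSum r 1 := conv_sum hp hq
  have hR0 : 0 ≤ R := hRr.nonneg fun n => by
    rcases hW n with h | h <;> simp [h, hr0 n]
  have hR1 : R ≤ 1 := hasSum_le (fun n => by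
    rcases hW n with h | h <;> simp [h, hr0 n]) hRr hr1
  let f : ℤ → ℝ := fun k => m * (I k - α)
  let ψ : ℤ → ℤ → ℝ := fun k n => f k * (W n - R) - f k ^ 2 / 8
  have hz := hasSum_mul2 hp.sum hq.sum
  have hzI := hasSum_mul2 hα hq.sum
  have hF0 := (((hasSum_mul2 hp.sum hq.ent.hasSum).add (hU.mul_left m)).add
    (hzI.mul_left (-(m * R) - m ^ 2 * (1 - 2 * α) / 8))).add
    ((hR.mul_left (-(m * α))).add (hz.mul_left (m * α * R - m ^ 2 * α ^ 2 / 8)))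
  have hF : HasSum (fun kl : ℤ × ℤ => p kl.1 * negMulLog (q kl.2) +
      p kl.1 * q kl.2 * ψ kl.1 (kl.1 + kl.2))
      (ent q + m * (U - α * R) - m ^ 2 * (α * (1 - α)) / 8) := by
    convert hF0 using 1
    · funext kl
      have : I kl.1 ^ 2 = I kl.1 := by rcases hI kl.1 with h | h <;> simp [h]
      simp only [ψ, f]
      linear_combination (-(p kl.1 * q kl.2) * m ^ 2 / 8) * this
    · simp only [ent]; ring
  -- inner sum
  have hin : ∀ k, HasSum (fun n => p k * (r n * exp (ψ k n)))
      (p k * (((1 - R) * exp (f k * (0 - R)) + R * exp (f k * (1 - R))) * exp (-(f k ^ 2 / 8)))) := by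
    intro k
    refine HasSum.mul_left _ ?_
    have h := (((hr1.sub hRr).mul_right (exp (f k * (0 - R)))).add
      (hRr.mul_right (exp (f k * (1 - R))))).mul_right (exp (-(f k ^ 2 / 8)))
    convert h using 1
    funext n
    simp only [ψ]
    rw [sub_eq_add_neg (f k * (W n - R)), exp_add]
    rcases hW n with h | h <;> simp [h] <;> ring
  have hin_le : ∀ k, p k * (((1 - R) * exp (f k * (0 - R)) + R * exp (f k * (1 - R))) *
      exp (-(f k ^ 2 / 8))) ≤ p k := by
    intro k
    refine mul_le_of_le_one_right (hp.nn k) ?_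
    calc _ ≤ exp (f k ^ 2 / 8) * exp (-(f k ^ 2 / 8)) := by
          gcongr; exact hoeff R (f k) hR0 hR1
      _ = 1 := by rw [← exp_add]; simp
  have hin_nn : ∀ k, 0 ≤ p k * (((1 - R) * exp (f k * (0 - R)) + R * exp (f k * (1 - R))) *
      exp (-(f k ^ 2 / 8))) := by
    intro k
    have : 0 ≤ 1 - R := by linarith
    have := hp.nn k
    positivity
  have hsum' : Summable (fun kn : ℤ × ℤ => p kn.1 * (r kn.2 * exp (ψ kn.1 kn.2))) := by
    rw [summable_prod_of_nonneg]
    · refine ⟨fun k => (hin k).summable, ?_⟩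
      refine Summable.of_nonneg_of_le (fun k => ?_) (fun k => ?_) hp.sum.summable
      · rw [(hin k).tsum_eq]; exact hin_nn k
      · rw [(hin k).tsum_eq]; exact hin_le k
    · intro kn
      exact mul_nonneg (hp.nn _) (mul_nonneg (hr0 _) (exp_pos _).le)
  have hb1 : ∑' kn : ℤ × ℤ, p kn.1 * (r kn.2 * exp (ψ kn.1 kn.2)) ≤ 1 :=
    hasSum_le hin_le (hsum'.hasSum.prod_fiberwise hin) hp.sum
  let e : ℤ × ℤ ≃ ℤ × ℤ :=
    { toFun := fun kl => (kl.1, kl.1 + kl.2)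
      invFun := fun kn => (kn.1, kn.2 - kn.1)
      left_inv := fun x => by simp
      right_inv := fun x => by simp }
  have hg := (e.hasSum_iff).2 hsum'.hasSum
  refine gibbs hp hq (fun kl => q kl.2 * exp (-(ψ kl.1 (kl.1 + kl.2)))) ?_ ?_ ?_ hF hg hb1
  · intro k l hk hl
    refine ⟨mul_pos hl (exp_pos _), ?_, ?_⟩
    · simp only
      rw [log_mul hl.ne' (exp_pos _).ne', log_exp, negMulLog]; ring
    · simp only [Function.comp, e, Equiv.coe_fn_mk]
      apply le_of_eq
      rw [exp_neg, ← hr]; field_simp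
  · intro k l h
    simp only [h]
    rcases mul_eq_zero.1 h with h | h <;> simp [h]
  · intro kl
    exact mul_nonneg (hp.nn _) (mul_nonneg (hr0 _) (exp_pos _).le)

noncomputable def ind (i k : ℤ) : ℝ := if k ≤ i then 1 else 0

lemma ind01 (i k : ℤ) : ind i k = 0 ∨ ind i k = 1 := by
  unfold ind; split_ifs <;> simp

lemma ind_nn (i k : ℤ) : 0 ≤ ind i k := by rcases ind01 i k with h | h <;> simp [h]
lemma ind_le (i k : ℤ) : ind i k ≤ 1 := by rcases ind01 i k with h | h <;> simp [h]

noncomputable def cdf (p : ℤ → ℝ) (i : ℤ) : ℝ := ∑' k, p k * ind i k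

lemma cdf_hasSum {p : ℤ → ℝ} (hp : IsPmf p) (i : ℤ) :
    HasSum (fun k => p k * ind i k) (cdf p i) := by
  refine (Summable.of_nonneg_of_le (fun k => mul_nonneg (hp.nn _) (ind_nn _ _)) (fun k => ?_)
    hp.sum.summable).hasSum
  exact mul_le_of_le_one_right (hp.nn _) (ind_le _ _)

lemma cdf_nn {p : ℤ → ℝ} (hp : IsPmf p) (i : ℤ) : 0 ≤ cdf p i :=
  (cdf_hasSum hp i).nonneg fun k => mul_nonneg (hp.nn _) (ind_nn _ _)

lemma cdf_le {p : ℤ → ℝ} (hp : IsPmf p) (i : ℤ) : cdf p i ≤ 1 :=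
  hasSum_le (fun k => mul_le_of_le_one_right (hp.nn _) (ind_le _ _)) (cdf_hasSum hp i) hp.sum

lemma cdf_pred {p : ℤ → ℝ} (hp : IsPmf p) (i : ℤ) : cdf p (i - 1) = cdf p i - p i := by
  have h := (cdf_hasSum hp i).sub (hasSum_ite_eq i (p i))
  refine HasSum.unique (cdf_hasSum hp (i - 1)) ?_
  have e : (fun k => p k * ind (i - 1) k) = fun k => p k * ind i k - if k = i then p i else 0 := by
    funext k
    unfold ind
    rcases lt_trichotomy k i with h | rfl | h
    · simp [h.ne, h.le, show k ≤ i - 1 by omega]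
    · simp
    · simp [h.ne', h, show ¬ k ≤ i by omega, show ¬ k ≤ i - 1 by omega]
  rw [e]; exact h

lemma exists_max {p : ℤ → ℝ} (hp : IsPmf p) : ∃ k, ∀ j, p j ≤ p k := by
  obtain ⟨k0, hk0⟩ : ∃ k, 0 < p k := by
    by_contra! h
    have : p = 0 := by funext k; exact le_antisymm (h k) (hp.nn k)
    have h2 := hp.sum
    rw [this] at h2
    exact zero_ne_one (hasSum_zero.unique h2)
  have h := hp.sum.summable.tendsto_cofinite_zero
  have h1 := h.eventually (gt_mem_nhds hk0)
  rw [Filter.eventually_cofinite] at h1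
  obtain ⟨k, hk, hmax⟩ := h1.exists_maximalFor p _ ⟨k0, by simp⟩
  refine ⟨k, fun j => ?_⟩
  simp only [not_lt, Set.mem_ofPred_eq] at hk hmax
  by_contra! hj
  have := hmax (hk.trans hj.le) hj.le
  linarith

lemma exists_split {p : ℤ → ℝ} (hp : IsPmf p) {x : ℝ} (hx : ∀ k, p k ≤ x) (hx1 : x ≤ 1) :
    ∃ i, (1 - x) / 2 ≤ cdf p i ∧ cdf p i ≤ 1 - (1 - x) / 2 := by
  rcases hx1.eq_or_lt with rfl | hlt
  · exact ⟨0, by simpa using cdf_nn hp 0, by simpa using cdf_le hp 0⟩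
  have hx0 : 0 ≤ x := (hp.nn 0).trans (hx 0)
  obtain ⟨T, hT⟩ := (hp.sum.eventually (lt_mem_nhds (show 1 - (1 - x) / 2 < 1 by linarith))).exists
  obtain ⟨N, hN⟩ : ∃ N, ∀ k ∈ T, k ≤ N := T.bddAbove
  obtain ⟨M, hM⟩ : ∃ M, ∀ k ∈ T, M ≤ k := T.bddBelow
  obtain ⟨i, hi, hmin⟩ := Int.exists_least_of_bdd (P := fun i => (1 - x) / 2 ≤ cdf p i)
    ⟨M, fun z hz => by
      by_contra! hlt
      have h1 := hp.sum.sub (cdf_hasSum hp z)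
      have h2 := sum_le_hasSum T (fun k _ => by
        have := mul_le_of_le_one_right (hp.nn k) (ind_le z k); linarith) h1
      have h3 : ∑ k ∈ T, (p k - p k * ind z k) = ∑ k ∈ T, p k := by
        refine Finset.sum_congr rfl fun k hk => ?_
        have := hM k hk
        simp [ind, show ¬ k ≤ z by omega]
      linarith⟩
    ⟨N, by
      have h2 := sum_le_hasSum T (fun k _ => mul_nonneg (hp.nn k) (ind_nn N k)) (cdf_hasSum hp N)
      have h3 : ∑ k ∈ T, p k * ind N k = ∑ k ∈ T, p k := by
        refine Finset.sum_congr rfl fun k hk => ?_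
        simp [ind, hN k hk]
      linarith⟩
  refine ⟨i, hi, ?_⟩
  have h1 : cdf p (i - 1) < (1 - x) / 2 := by
    by_contra! h; have := hmin _ h; omega
  rw [cdf_pred hp] at h1
  have := hx i
  linarith

lemma summ_z {p q : ℤ → ℝ} (hp : IsPmf p) (hq : IsPmf q) {f : ℤ × ℤ → ℝ}
    (h0 : ∀ kl, 0 ≤ f kl) (h1 : ∀ kl, f kl ≤ 1) :
    Summable (fun kl : ℤ × ℤ => p kl.1 * q kl.2 * f kl) := by
  have hz : ∀ kl : ℤ × ℤ, 0 ≤ p kl.1 * q kl.2 := fun kl => mul_nonneg (hp.nn _) (hq.nn _)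
  refine Summable.of_nonneg_of_le (fun kl => mul_nonneg (hz kl) (h0 kl)) (fun kl => ?_)
    (hasSum_mul2 hp.sum hq.sum).summable
  exact mul_le_of_le_one_right (hz kl) (h1 kl)

/-- one sided bound `D ≥ 2 A y²` -/
lemma side {p q : ℤ → ℝ} (hp : IsPmf p) (hq : IsPmf q) (i l0 : ℤ) :
    ent q + 2 * (cdf p i * (1 - cdf p i)) * q l0 ^ 2 ≤ ent (conv p q) := by
  set α := cdf p i with hα
  have hα0 : 0 ≤ α := cdf_nn hp i
  have hα1 : α ≤ 1 := cdf_le hp i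
  let W := ind (i + l0)
  have hU := (summ_z hp hq (f := fun kl => ind i kl.1 * W (kl.1 + kl.2))
    (fun kl => mul_nonneg (ind_nn _ _) (ind_nn _ _))
    (fun kl => mul_le_one₀ (ind_le _ _) (ind_nn _ _) (ind_le _ _))).hasSum
  have hR := (summ_z hp hq (f := fun kl => W (kl.1 + kl.2))
    (fun kl => (ind_nn _ _)) (fun kl => (ind_le _ _))).hasSum
  set U := ∑' kl : ℤ × ℤ, p kl.1 * q kl.2 * (ind i kl.1 * W (kl.1 + kl.2))
  set R := ∑' kl : ℤ × ℤ, p kl.1 * q kl.2 * (W (kl.1 + kl.2))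
  have hz : ∀ kl : ℤ × ℤ, 0 ≤ p kl.1 * q kl.2 := fun kl => mul_nonneg (hp.nn _) (hq.nn _)
  have h1 : α * cdf q l0 ≤ U := by
    refine hasSum_le ?_ (hasSum_mul2 (cdf_hasSum hp i) (cdf_hasSum hq l0)) hU
    rintro ⟨k, l⟩
    have : ind i k * ind l0 l ≤ ind i k * W (k + l) := by
      simp only [W, ind]; split_ifs <;> first | omega | norm_num
    have := mul_le_mul_of_nonneg_left this (hz (k, l))
    simp only at *
    linarith
  have h2 : R - U ≤ (1 - α) * cdf q (l0 - 1) := by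
    refine hasSum_le ?_ (hR.sub hU) (hasSum_mul2 (hp.sum.sub (cdf_hasSum hp i)) (cdf_hasSum hq (l0 - 1)))
    rintro ⟨k, l⟩
    have : W (k + l) - ind i k * W (k + l) ≤ (1 - ind i k) * ind (l0 - 1) l := by
      simp only [W, ind]; split_ifs <;> first | omega | norm_num
    have := mul_le_mul_of_nonneg_left this (hz (k, l))
    simp only at *
    linarith
  rw [cdf_pred hq] at h2
  have h3 := key2 hp hq (ind01 i) (ind01 _) (cdf_hasSum hp i) hU hR (4 * q l0)
  rw [← hα] at h3
  have h4 : α * (1 - α) * q l0 ≤ U - α * R := by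
    have := mul_le_mul_of_nonneg_left h1 (sub_nonneg.2 hα1)
    have := mul_le_mul_of_nonneg_left h2 hα0
    linarith
  have := mul_le_mul_of_nonneg_left h4 (hq.nn l0)
  linarith

lemma arith0 {s t d1 d2 : ℝ} (hs : 0 < s) (ht : 0 < t) (hsum : (s + t) / 2 ≤ d1 + d2) :
    s * t * (s + t) / 4 ≤ s * d1 ^ 2 + t * d2 ^ 2 := by
  have hst : 0 < s + t := by linarith
  have h : s * t * ((s + t) / 2) ^ 2 ≤ s * t * (d1 + d2) ^ 2 := by gcongr
  have h5 : (s + t) * (s * t * (s + t) / 4) ≤ (s + t) * (s * d1 ^ 2 + t * d2 ^ 2) := by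
    have := sq_nonneg (s * d1 - t * d2)
    linarith
  exact le_of_mul_le_mul_left h5 hst

lemma arith1 {s t α β m12 m21 D1 D2 : ℝ} (hs : 0 ≤ s) (ht : 0 ≤ t) (hs1 : s ≤ 1) (ht1 : t ≤ 1)
    (hα : s / 2 ≤ α) (hα' : α ≤ 1 - s / 2) (hβ : t / 2 ≤ β) (hβ' : β ≤ 1 - t / 2)
    (h1 : 0 ≤ m12) (h1' : m12 ≤ α * (1 - β)) (h2 : 0 ≤ m21) (h2' : m21 ≤ (1 - α) * β)
    (hD1 : ∀ m, m * (α * β + m12 - α * (α * β + m12 + m21)) - m ^ 2 * (α * (1 - α)) / 8 ≤ D1)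
    (hD2 : ∀ m, m * (α * β + m21 - β * (α * β + m12 + m21)) - m ^ 2 * (β * (1 - β)) / 8 ≤ D2) :
    s * t * (s + t) / 8 ≤ D1 + D2 := by
  have p1 : 0 ≤ D1 := by simpa using hD1 0
  have p2 : 0 ≤ D2 := by simpa using hD2 0
  rcases hs.eq_or_lt with rfl | hs
  · simp; linarith
  rcases ht.eq_or_lt with rfl | ht
  · simp; linarith
  have hA : s / 4 ≤ α * (1 - α) := by nlinarith
  have hB : t / 4 ≤ β * (1 - β) := by nlinarith
  have a0 : 0 < α := by linarith
  have a1 : 0 < 1 - α := by linarith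
  have b0 : 0 < β := by linarith
  have b1 : 0 < 1 - β := by linarith
  obtain ⟨u, rfl⟩ : ∃ u, m12 = α * (1 - β) * u := ⟨m12 / (α * (1 - β)), by field_simp⟩
  obtain ⟨v, rfl⟩ : ∃ v, m21 = (1 - α) * β * v := ⟨m21 / ((1 - α) * β), by field_simp⟩
  have hu0 : 0 ≤ u := nonneg_of_mul_nonneg_right h1 (mul_pos a0 b1)
  have hv0 : 0 ≤ v := nonneg_of_mul_nonneg_right h2 (mul_pos a1 b0)
  have hu1 : u ≤ 1 := by
    have := mul_pos a0 b1
    by_contra! h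
    nlinarith
  have hv1 : v ≤ 1 := by
    have := mul_pos a1 b0
    by_contra! h
    nlinarith
  set d1 := β + (1 - β) * u - β * v with hd1
  set d2 := α + (1 - α) * v - α * u with hd2
  have e1 : 2 * (α * (1 - α)) * d1 ^ 2 ≤ D1 := by
    have := hD1 (4 * d1)
    rw [hd1] at *
    linarith
  have e2 : 2 * (β * (1 - β)) * d2 ^ 2 ≤ D2 := by
    have := hD2 (4 * d2)
    rw [hd2] at *
    linarith
  have hsum : (s + t) / 2 ≤ d1 + d2 := by
    have : d1 + d2 = (α + β) + (1 - α - β) * (u + v) := by rw [hd1, hd2]; ring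
    rw [this]
    rcases le_total (α + β) 1 with h | h
    · have := mul_nonneg (sub_nonneg.2 h) (add_nonneg hu0 hv0)
      linarith
    · have := mul_nonneg (sub_nonneg.2 h) (show 0 ≤ 2 - u - v by linarith)
      linarith
  have f1 := mul_le_mul_of_nonneg_right hA (sq_nonneg d1)
  have f2 := mul_le_mul_of_nonneg_right hB (sq_nonneg d2)
  have key := arith0 hs ht hsum
  linarith

lemma quad {p q : ℤ → ℝ} (hp : IsPmf p) (hq : IsPmf q) {x y : ℝ} (hx1 : x ≤ 1) (hy1 : y ≤ 1)
    (hx0 : 0 ≤ x) (hy0 : 0 ≤ y) (i j : ℤ)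
    (hi : (1 - x) / 2 ≤ cdf p i) (hi' : cdf p i ≤ 1 - (1 - x) / 2)
    (hj : (1 - y) / 2 ≤ cdf q j) (hj' : cdf q j ≤ 1 - (1 - y) / 2) :
    (1 - x) * (1 - y) * ((1 - x) + (1 - y)) / 8 ≤ 2 * ent (conv p q) - ent p - ent q := by
  let W := ind (i + j)
  have hW0 : ∀ k, 0 ≤ W k := ind_nn _
  have hW1 : ∀ k, W k ≤ 1 := ind_le _
  have hz : ∀ kl : ℤ × ℤ, 0 ≤ p kl.1 * q kl.2 := fun kl => mul_nonneg (hp.nn _) (hq.nn _)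
  have h12 := (summ_z hp hq (f := fun kl => ind i kl.1 * (1 - ind j kl.2) * W (kl.1 + kl.2))
    (fun kl => by simp only [W, ind]; split_ifs <;> norm_num)
    (fun kl => by simp only [W, ind]; split_ifs <;> norm_num)).hasSum
  have h21 := (summ_z hp hq (f := fun kl => (1 - ind i kl.1) * ind j kl.2 * W (kl.1 + kl.2))
    (fun kl => by simp only [W, ind]; split_ifs <;> norm_num)
    (fun kl => by simp only [W, ind]; split_ifs <;> norm_num)).hasSum
  set m12 := ∑' kl : ℤ × ℤ, p kl.1 * q kl.2 * (ind i kl.1 * (1 - ind j kl.2) * W (kl.1 + kl.2))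
  set m21 := ∑' kl : ℤ × ℤ, p kl.1 * q kl.2 * ((1 - ind i kl.1) * ind j kl.2 * W (kl.1 + kl.2))
  have hP := hasSum_mul2 (cdf_hasSum hp i) (cdf_hasSum hq j)
  have hU : HasSum (fun kl : ℤ × ℤ => p kl.1 * q kl.2 * (ind i kl.1 * W (kl.1 + kl.2)))
      (cdf p i * cdf q j + m12) := by
    convert hP.add h12 using 1
    funext kl
    have : ind i kl.1 * W (kl.1 + kl.2) = ind i kl.1 * ind j kl.2 +
      ind i kl.1 * (1 - ind j kl.2) * W (kl.1 + kl.2) := by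
      simp only [W, ind]; split_ifs <;> first | omega | norm_num
    rw [this]; ring
  have hU' : HasSum (fun kl : ℤ × ℤ => p kl.1 * q kl.2 * (ind j kl.2 * W (kl.1 + kl.2)))
      (cdf p i * cdf q j + m21) := by
    convert hP.add h21 using 1
    funext kl
    have : ind j kl.2 * W (kl.1 + kl.2) = ind i kl.1 * ind j kl.2 +
      (1 - ind i kl.1) * ind j kl.2 * W (kl.1 + kl.2) := by
      simp only [W, ind]; split_ifs <;> first | omega | norm_num
    rw [this]; ring
  have hR : HasSum (fun kl : ℤ × ℤ => p kl.1 * q kl.2 * (W (kl.1 + kl.2)))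
      (cdf p i * cdf q j + m12 + m21) := by
    convert (hP.add h12).add h21 using 1
    funext kl
    have : W (kl.1 + kl.2) = ind i kl.1 * ind j kl.2 +
      ind i kl.1 * (1 - ind j kl.2) * W (kl.1 + kl.2) +
      (1 - ind i kl.1) * ind j kl.2 * W (kl.1 + kl.2) := by
      simp only [W, ind]; split_ifs <;> first | omega | norm_num
    rw [this]
    have h9 : ind i kl.1 * ind j kl.2 * W (kl.1 + kl.2) = ind i kl.1 * ind j kl.2 := by
      simp only [W, ind]; split_ifs <;> first | omega | norm_num
    have h10 : (1 - ind i kl.1) * (1 - ind j kl.2) * W (kl.1 + kl.2) = 0 := by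
      simp only [W, ind]; split_ifs <;> first | omega | norm_num
    rw [← this]
    linear_combination p kl.1 * q kl.2 * this
  have hUs := ((Equiv.prodComm ℤ ℤ).hasSum_iff).2 hU'
  have hRs := ((Equiv.prodComm ℤ ℤ).hasSum_iff).2 hR
  have hD1 := key2 hp hq (ind01 i) (ind01 (i + j)) (cdf_hasSum hp i) hU hR
  have hD2 := key2 hq hp (ind01 j) (ind01 (i + j)) (cdf_hasSum hq j)
    (U := cdf p i * cdf q j + m21) (R := cdf p i * cdf q j + m12 + m21)
    (by convert hUs using 1; funext kl; simp [W, mul_comm, add_comm, Function.comp])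
    (by convert hRs using 1; funext kl; simp [W, mul_comm, add_comm, Function.comp])
  rw [conv_comm] at hD2
  have h12n : 0 ≤ m12 := h12.nonneg fun kl => mul_nonneg (hz kl) (by
    simp only [W, ind]; split_ifs <;> norm_num)
  have h21n : 0 ≤ m21 := h21.nonneg fun kl => mul_nonneg (hz kl) (by
    simp only [W, ind]; split_ifs <;> norm_num)
  have h12l : m12 ≤ cdf p i * (1 - cdf q j) := by
    refine hasSum_le ?_ h12 (hasSum_mul2 (cdf_hasSum hp i) (hq.sum.sub (cdf_hasSum hq j)))
    intro kl
    have : ind i kl.1 * (1 - ind j kl.2) * W (kl.1 + kl.2) ≤ ind i kl.1 * (1 - ind j kl.2) := by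
      simp only [W, ind]; split_ifs <;> norm_num
    have := mul_le_mul_of_nonneg_left this (hz kl)
    linarith
  have h21l : m21 ≤ (1 - cdf p i) * cdf q j := by
    refine hasSum_le ?_ h21 (hasSum_mul2 (hp.sum.sub (cdf_hasSum hp i)) (cdf_hasSum hq j))
    intro kl
    have : (1 - ind i kl.1) * ind j kl.2 * W (kl.1 + kl.2) ≤ (1 - ind i kl.1) * ind j kl.2 := by
      simp only [W, ind]; split_ifs <;> norm_num
    have := mul_le_mul_of_nonneg_left this (hz kl)
    linarith
  have := arith1 (s := 1 - x) (t := 1 - y) (D1 := ent (conv p q) - ent q)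
    (D2 := ent (conv p q) - ent p) (by linarith) (by linarith) (by linarith) (by linarith) hi hi' hj hj'
    h12n h12l h21n h21l (fun m => by have := hD1 m; linarith) (fun m => by have := hD2 m; linarith)
  linarith

end S17

namespace S17
open Real

lemma pr_hasSum {Ω : Type*} [MeasurableSpace Ω] (μ : Measure Ω) [IsProbabilityMeasure μ]
    {X : Ω → ℤ} (hX : Measurable X) {A : Set Ω} (hA : MeasurableSet A) :
    HasSum (fun k => pr μ ({ω | X ω = k} ∩ A)) (pr μ A) := by
  have hm : ∀ k, MeasurableSet ({ω | X ω = k} ∩ A) := fun k =>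
    (hX (measurableSet_singleton k)).inter hA
  have h1 : μ A = ∑' k, μ ({ω | X ω = k} ∩ A) := by
    rw [← measure_iUnion _ hm]
    · congr 1; ext ω; simp
    · intro i j hij
      rw [Function.onFun, Set.disjoint_left]
      rintro ω ⟨h1, _⟩ ⟨h2, _⟩
      exact hij (h1.symm.trans h2)
  have hne : ∑' k, μ ({ω | X ω = k} ∩ A) ≠ ⊤ := by rw [← h1]; exact measure_ne_top _ _
  have h2 := ENNReal.hasSum_toReal hne
  unfold pr
  rw [h1, ENNReal.tsum_toReal_eq (fun k => measure_ne_top _ _)]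
  exact h2

lemma delta_pmf : IsPmf (fun k : ℤ => if k = 0 then 1 else 0) where
  nn k := by split_ifs <;> norm_num
  sum := hasSum_ite_eq 0 1
  ent := by
    have : (fun k : ℤ => negMulLog (if k = 0 then (1:ℝ) else 0)) = fun _ => 0 := by
      funext k; split_ifs <;> simp
    rw [this]; exact summable_zero

lemma logb_term (a p : ℝ) : -(a * p * Real.logb 2 (a * p / a)) = a * negMulLog p / Real.log 2 := by
  rcases eq_or_ne a 0 with rfl | ha
  · simp
  · rw [mul_div_cancel_left₀ _ ha, Real.logb, negMulLog]; ring

lemma cond_exists {Ω : Type*} [MeasurableSpace Ω] (μ : Measure Ω) [IsProbabilityMeasure μ]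
    {X Y : Ω → ℤ} (hX : Measurable X) (hY : Measurable Y) (b : ℤ)
    (hs : Summable (condEntTerm μ X Y)) :
    ∃ p, IsPmf p ∧ ∀ k, pr μ {ω | X ω = k ∧ Y ω = b} = pr μ {ω | Y ω = b} * p k := by
  have hsum : HasSum (fun k => pr μ {ω | X ω = k ∧ Y ω = b}) (pr μ {ω | Y ω = b}) :=
    pr_hasSum μ hX (hY (measurableSet_singleton b))
  have hnn : ∀ A : Set Ω, 0 ≤ pr μ A := fun A => ENNReal.toReal_nonneg
  have hs' : Summable fun k => condEntTerm μ X Y (k, b) :=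
    hs.comp_injective (i := fun k : ℤ => (k, b)) (fun i j h => by simpa using h)
  set a := pr μ {ω | Y ω = b} with ha
  rcases eq_or_ne a 0 with h0 | h0
  · refine ⟨_, delta_pmf, fun k => ?_⟩
    rw [h0, zero_mul]
    refine le_antisymm ?_ (hnn _)
    rw [← h0]; exact le_hasSum hsum k (fun j _ => hnn _)
  · have hap : 0 < a := lt_of_le_of_ne (hnn _) h0.symm
    have hj : ∀ k, pr μ {ω | X ω = k ∧ Y ω = b} = a * (pr μ {ω | X ω = k ∧ Y ω = b} / a) := by
      intro k; field_simp
    refine ⟨fun k => pr μ {ω | X ω = k ∧ Y ω = b} / a, ⟨fun k => div_nonneg (hnn _) hap.le, ?_, ?_⟩, hj⟩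
    · simpa [h0] using hsum.div_const a
    · refine (hs'.mul_left (Real.log 2 / a)).congr fun k => ?_
      unfold condEntTerm
      simp only
      rw [← ha, hj k, logb_term]
      have := (Real.log_pos one_lt_two).ne'
      field_simp

lemma hasSum_fin {B : Type*} [DecidableEq B] {f : ℤ × B → ℝ} (F : Finset B) {g : B → ℝ}
    (h0 : ∀ k, ∀ b ∉ F, f (k, b) = 0) (h : ∀ b ∈ F, HasSum (fun k => f (k, b)) (g b)) :
    HasSum f (∑ b ∈ F, g b) := by
  have h1 : ∀ b ∈ F, HasSum (fun kb : ℤ × B => if kb.2 = b then f kb else 0) (g b) := by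
    intro b hb
    have hi : Function.Injective (fun k : ℤ => (k, b)) := fun i j h => by simpa using h
    rw [← hi.hasSum_iff]
    · simpa [Function.comp_def] using h b hb
    · rintro ⟨k, b'⟩ hkb
      have : b' ≠ b := by rintro rfl; exact hkb ⟨k, rfl⟩
      simp [this]
  convert hasSum_sum h1 using 1
  funext kb
  by_cases hb : kb.2 ∈ F
  · simp [hb]
  · simp [h0 kb.1 kb.2 hb]

lemma condEnt_eq {Ω : Type*} [MeasurableSpace Ω] (μ : Measure Ω) [IsProbabilityMeasure μ]
    {X Y : Ω → ℤ} (hY01 : ∀ ω, Y ω = 0 ∨ Y ω = 1) {p0 p1 : ℤ → ℝ} (h0 : IsPmf p0) (h1 : IsPmf p1)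
    (e0 : ∀ k, pr μ {ω | X ω = k ∧ Y ω = 0} = pr μ {ω | Y ω = 0} * p0 k)
    (e1 : ∀ k, pr μ {ω | X ω = k ∧ Y ω = 1} = pr μ {ω | Y ω = 1} * p1 k) :
    HasSum (condEntTerm μ X Y)
      (pr μ {ω | Y ω = 0} * ent p0 / Real.log 2 + pr μ {ω | Y ω = 1} * ent p1 / Real.log 2) := by
  have := hasSum_fin (f := condEntTerm μ X Y) {0, 1}
    (g := fun b => if b = 0 then pr μ {ω | Y ω = 0} * ent p0 / Real.log 2 else
      pr μ {ω | Y ω = 1} * ent p1 / Real.log 2) ?_ ?_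
  · simpa using this
  · intro k b hb
    simp at hb
    have : {ω | X ω = k ∧ Y ω = b} = ∅ := by
      ext ω; rcases hY01 ω with h | h <;> simp [h] <;> intro _ <;> tauto
    simp [condEntTerm, this, pr]
  · intro b hb
    simp at hb
    rcases hb with rfl | rfl
    · simp only [condEntTerm, e0, logb_term]
      exact (h0.ent.hasSum.mul_left _).div_const _
    · simp only [condEntTerm, e1, logb_term]
      exact (h1.ent.hasSum.mul_left _).div_const _

lemma indep_pr {Ω : Type*} [MeasurableSpace Ω] (μ : Measure Ω)
    {X Y X' Y' : Ω → ℤ} 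
    (hindep : IndepFun (fun ω => (X ω, Y ω)) (fun ω => (X' ω, Y' ω)) μ) (S T : Set (ℤ × ℤ)) :
    pr μ ({ω | (X ω, Y ω) ∈ S} ∩ {ω | (X' ω, Y' ω) ∈ T}) =
      pr μ {ω | (X ω, Y ω) ∈ S} * pr μ {ω | (X' ω, Y' ω) ∈ T} := by
  have := hindep.measure_inter_preimage_eq_mul S T (.of_discrete) (.of_discrete)
  unfold pr
  rw [← ENNReal.toReal_mul]
  exact congrArg ENNReal.toReal this

lemma pr_conv {Ω : Type*} [MeasurableSpace Ω] (μ : Measure Ω) [IsProbabilityMeasure μ]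
    {X Y X' Y' : Ω → ℤ} (hX : Measurable X) (hY : Measurable Y)
    (hX' : Measurable X') (hY' : Measurable Y')
    (hindep : IndepFun (fun ω => (X ω, Y ω)) (fun ω => (X' ω, Y' ω)) μ) (b b' : ℤ)
    {p q : ℤ → ℝ}
    (e0 : ∀ k, pr μ {ω | X ω = k ∧ Y ω = b} = pr μ {ω | Y ω = b} * p k)
    (e1 : ∀ k, pr μ {ω | X' ω = k ∧ Y' ω = b'} = pr μ {ω | Y' ω = b'} * q k) :
    pr μ {ω | (Y ω, Y' ω) = (b, b')} = pr μ {ω | Y ω = b} * pr μ {ω | Y' ω = b'} ∧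
    ∀ n, pr μ {ω | X ω + X' ω = n ∧ (Y ω, Y' ω) = (b, b')} =
      pr μ {ω | Y ω = b} * pr μ {ω | Y' ω = b'} * conv p q n := by
  constructor
  · have := indep_pr μ hindep {x | x.2 = b} {x | x.2 = b'}
    simp only [Set.mem_ofPred_eq] at this
    rw [← this]; congr 1; ext ω; simp
  · intro n
    have hA : MeasurableSet {ω | X ω + X' ω = n ∧ (Y ω, Y' ω) = (b, b')} :=
      ((hX.add hX') (measurableSet_singleton n)).inter
        ((hY.prodMk hY') (measurableSet_singleton (b, b')))
    rw [← (pr_hasSum μ hX hA).tsum_eq, conv, ← tsum_mul_left]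
    refine tsum_congr fun k => ?_
    have := indep_pr μ hindep {x | x.1 = k ∧ x.2 = b} {x | x.1 = n - k ∧ x.2 = b'}
    simp only [Set.mem_ofPred_eq] at this
    rw [e0, e1] at this
    have e : {ω | X ω = k} ∩ {ω | X ω + X' ω = n ∧ (Y ω, Y' ω) = (b, b')} =
      {ω | X ω = k ∧ Y ω = b} ∩ {ω | X' ω = n - k ∧ Y' ω = b'} := by
      ext ω; simp; constructor
      · rintro ⟨h1, h2, h3, h4⟩; refine ⟨⟨h1, h3⟩, by omega, h4⟩
      · rintro ⟨⟨h1, h2⟩, h3, h4⟩; refine ⟨h1, by omega, h2, h4⟩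
    rw [e, this]; ring

lemma condEnt_sum {Ω : Type*} [MeasurableSpace Ω] (μ : Measure Ω) [IsProbabilityMeasure μ]
    {X Y X' Y' : Ω → ℤ} (hX : Measurable X) (hY : Measurable Y)
    (hX' : Measurable X') (hY' : Measurable Y')
    (hindep : IndepFun (fun ω => (X ω, Y ω)) (fun ω => (X' ω, Y' ω)) μ)
    (hY01 : ∀ ω, Y ω = 0 ∨ Y ω = 1) (hY'01 : ∀ ω, Y' ω = 0 ∨ Y' ω = 1)
    {p q : ℤ → ℤ → ℝ} (hp : ∀ b, IsPmf (p b)) (hq : ∀ b, IsPmf (q b))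
    (e0 : ∀ b k, pr μ {ω | X ω = k ∧ Y ω = b} = pr μ {ω | Y ω = b} * p b k)
    (e1 : ∀ b k, pr μ {ω | X' ω = k ∧ Y' ω = b} = pr μ {ω | Y' ω = b} * q b k) :
    condEnt μ (fun ω => X ω + X' ω) (fun ω => (Y ω, Y' ω)) = 
     ∑ b ∈ ({0, 1} : Finset ℤ), ∑ b' ∈ ({0, 1} : Finset ℤ), 
       pr μ {ω | Y ω = b} * pr μ {ω | Y' ω = b'} * ent (conv (p b) (q b')) / Real.log 2 := by
  rw [← Finset.sum_product (s := {0, 1}) (t := {0, 1}) (f := fun bb : ℤ × ℤ => pr μ {ω | Y ω = bb.1} * pr μ {ω | Y' ω = bb.2} * ent (conv (p bb.1) (q bb.2)) / Real.log 2)]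
  refine HasSum.tsum_eq (hasSum_fin _ ?_ ?_)
  · rintro k ⟨b, b'⟩ hb
    have : {ω | X ω + X' ω = k ∧ (Y ω, Y' ω) = (b, b')} = ∅ := by
      ext ω
      simp only [Set.mem_ofPred_eq, Set.mem_empty_iff_false, iff_false, Prod.mk.injEq]
      rintro ⟨_, rfl, rfl⟩
      apply hb
      simp [hY01 ω, hY'01 ω]
    simp only [condEntTerm, this, pr]; simp
  · rintro ⟨b, b'⟩ _
    obtain ⟨h1, h2⟩ := pr_conv μ hX hY hX' hY' hindep b b' (e0 b) (e1 b')
    simp only [condEntTerm, h2, h1, logb_term]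
    exact ((conv_ent (hp b) (hq b')).2.hasSum.mul_left _).div_const _

end S17

namespace S17
open Real

lemma H2_eq (x : ℝ) : H2 x = binEntropy x / Real.log 2 := by
  simp only [H2, binEntropy, Real.logb, Real.log_inv]; ring

lemma pair {p q : ℤ → ℝ} (hp : IsPmf p) (hq : IsPmf q) (k l : ℤ) (hk : ∀ j, p j ≤ p k)
    (hl : ∀ j, q j ≤ q l) :
    (ent q * p k - binEntropy (p k) + ent p * q l - binEntropy (q l)
      ≤ 2 * ent (conv p q) - ent p - ent q) ∧
    ((1 - p k) * (1 - q l) * ((1 - p k) + (1 - q l)) / 8 ≤ 2 * ent (conv p q) - ent p - ent q) ∧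
    ((1 - p k) * q l ^ 2 / 2 + (1 - q l) * p k ^ 2 / 2 ≤ 2 * ent (conv p q) - ent p - ent q) := by
  have hx0 := hp.nn k
  have hx1 := hp.le_one k
  have hy0 := hq.nn l
  have hy1 := hq.le_one l
  obtain ⟨i, hi, hi'⟩ := exists_split hp hk hx1
  obtain ⟨j, hj, hj'⟩ := exists_split hq hl hy1
  refine ⟨?_, quad hp hq hx1 hy1 hx0 hy0 i j hi hi' hj hj', ?_⟩
  · have h1 := key1 hp hq l
    have h2 := key1 hq hp k
    rw [conv_comm] at h2
    rw [binEntropy_eq_negMulLog_add_negMulLog_one_sub, binEntropy_eq_negMulLog_add_negMulLog_one_sub]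
    linarith
  · have h1 := side hp hq i l
    have h2 := side hq hp j k
    rw [conv_comm] at h2
    have hA : (1 - p k) / 4 ≤ cdf p i * (1 - cdf p i) := by nlinarith
    have hB : (1 - q l) / 4 ≤ cdf q j * (1 - cdf q j) := by nlinarith
    have f1 := mul_le_mul_of_nonneg_right hA (sq_nonneg (q l))
    have f2 := mul_le_mul_of_nonneg_right hB (sq_nonneg (p k))
    linarith

lemma lfun_le {x y K : ℝ} (hx0 : 0 ≤ x) (hx1 : x ≤ 1) (hy0 : 0 ≤ y) (hy1 : y ≤ 1)
    (h1 : (1 - x) * (1 - y) * ((1 - x) + (1 - y)) / 8 ≤ K)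
    (h2 : (1 - x) * y ^ 2 / 2 + (1 - y) * x ^ 2 / 2 ≤ K) :
    lfun x y ≤ K / Real.log 2 := by
  have hlog := Real.log_pos one_lt_two
  have main : ∀ a b : ℝ, (a, b) ∈ Tset x y → (1 - x) ^ 2 * a ^ 2 + (1 - y) ^ 2 * b ^ 2 ≤ 8 * K →
      lfun x y ≤ K / Real.log 2 := by
    intro a b hT hab
    refine (csInf_le ?_ (Set.mem_image_of_mem _ hT)).trans ?_
    · refine ⟨0, ?_⟩
      rintro _ ⟨ab, _, rfl⟩
      positivity
    · simp only
      rw [div_le_div_iff₀ (by positivity) hlog]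
      nlinarith
  obtain ⟨s, rfl⟩ : ∃ s, x = 1 - s := ⟨1 - x, by ring⟩
  obtain ⟨t, rfl⟩ : ∃ t, y = 1 - t := ⟨1 - y, by ring⟩
  simp only [sub_sub_cancel] at *
  have hs0 : 0 ≤ s := by linarith
  have ht0 : 0 ≤ t := by linarith
  have hs1 : s ≤ 1 := by linarith
  have ht1 : t ≤ 1 := by linarith
  have hss : s ^ 2 ≤ s := by nlinarith
  have htt : t ^ 2 ≤ t := by nlinarith
  rcases le_total s (2 / 5) with hs | hs <;> rcases le_total t (2 / 5) with ht | ht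
  · refine main (2 - 4 * t) (2 - 4 * s) ?_ ?_
    · simp only [Tset, Set.mem_ofPred_eq]
      refine ⟨by linarith, by linarith, max_le (by linarith) (by linarith),
        max_le (by linarith) (by linarith), by linarith⟩
    · have a1 : s ^ 2 * (2 - 4 * t) ^ 2 ≤ s * (2 - 2 * t) ^ 2 := by
        gcongr <;> linarith
      have a2 : t ^ 2 * (2 - 4 * s) ^ 2 ≤ t * (2 - 2 * s) ^ 2 := by
        gcongr <;> linarith
      linarith
  · refine main t (2 - 4 * s) ?_ ?_
    · simp only [Tset, Set.mem_ofPred_eq]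
      refine ⟨by linarith, by linarith, max_le (by linarith) (by linarith),
        max_le (by linarith) (by linarith), by linarith⟩
    · have a1 : t ^ 2 * (s ^ 2 + (2 - 4 * s) ^ 2) ≤ t * (2 - 2 * s) ^ 2 := by
        gcongr; nlinarith
      have a2 : 0 ≤ s * (1 - t) ^ 2 := by positivity
      linarith
  · refine main (2 - 4 * t) s ?_ ?_
    · simp only [Tset, Set.mem_ofPred_eq]
      refine ⟨by linarith, by linarith, max_le (by linarith) (by linarith),
        max_le (by linarith) (by linarith), by linarith⟩
    · have a1 : s ^ 2 * (t ^ 2 + (2 - 4 * t) ^ 2) ≤ s * (2 - 2 * t) ^ 2 := by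
        gcongr; nlinarith
      have a2 : 0 ≤ t * (1 - s) ^ 2 := by positivity
      linarith
  · refine main t s ?_ ?_
    · simp only [Tset, Set.mem_ofPred_eq]
      refine ⟨by linarith, by linarith, max_le (by linarith) (by linarith),
        max_le (by linarith) (by linarith), by linarith⟩
    · have a1 : 2 * (s * t) ≤ s + t := by nlinarith
      have := mul_le_mul_of_nonneg_left a1 (mul_nonneg hs0 ht0)
      linarith

lemma lfun_nn (x y : ℝ) : 0 ≤ lfun x y := by
  have hlog := Real.log_pos one_lt_two
  refine Real.sInf_nonneg ?_
  rintro _ ⟨ab, _, rfl⟩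
  positivity

lemma g_le {x y c M : ℝ} (hx0 : 0 ≤ x) (hx1 : x ≤ 1) (hy0 : 0 ≤ y) (hy1 : y ≤ 1)
    (h1 : c * x - H2 x + c * y - H2 y ≤ M) (h2 : lfun x y ≤ M) : gNIID c c ≤ (1 / 2) * M := by
  unfold gNIID
  refine mul_le_mul_of_nonneg_left ?_ (by norm_num)
  refine (csInf_le ?_ (Set.mem_image_of_mem _ (show (x, y) ∈ Set.Icc (0 : ℝ) 1 ×ˢ Set.Icc (0 : ℝ) 1 from ⟨⟨hx0, hx1⟩, ⟨hy0, hy1⟩⟩))).trans (max_le h1 h2)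
  refine ⟨0, ?_⟩
  rintro _ ⟨xy, _, rfl⟩
  exact le_max_of_le_right (lfun_nn _ _)

lemma conc {w0 w1 x0 x1 : ℝ} (hw0 : 0 ≤ w0) (hw1 : 0 ≤ w1) (hw : w0 + w1 = 1)
    (h0 : x0 ∈ Set.Icc (0:ℝ) 1) (h1 : x1 ∈ Set.Icc (0:ℝ) 1) :
    w0 * binEntropy x0 + w1 * binEntropy x1 ≤ binEntropy (w0 * x0 + w1 * x1) := by
  simpa using strictConcave_binEntropy.concaveOn.2 h0 h1 hw0 hw1 hw

lemma var2 {w0 w1 : ℝ} (x0 x1 : ℝ) (hw0 : 0 ≤ w0) (hw1 : 0 ≤ w1) (hw : w0 + w1 = 1) :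
    (w0 * x0 + w1 * x1) ^ 2 ≤ w0 * x0 ^ 2 + w1 * x1 ^ 2 := by
  have : w1 = 1 - w0 := by linarith
  subst this
  nlinarith [mul_nonneg (mul_nonneg hw0 hw1) (sq_nonneg (x0 - x1))]

lemma avg4 {w0 w1 v0 v1 a00 a01 a10 a11 b00 b01 b10 b11 : ℝ} (hw0 : 0 ≤ w0) (hw1 : 0 ≤ w1)
    (hv0 : 0 ≤ v0) (hv1 : 0 ≤ v1) (h00 : a00 ≤ b00) (h01 : a01 ≤ b01) (h10 : a10 ≤ b10)
    (h11 : a11 ≤ b11) :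
    w0 * v0 * a00 + w0 * v1 * a01 + w1 * v0 * a10 + w1 * v1 * a11 ≤
    w0 * v0 * b00 + w0 * v1 * b01 + w1 * v0 * b10 + w1 * v1 * b11 := by
  gcongr

end S17

open S17

/-- for independent pairs `(X,Y)`, `(X',Y')` with `Y, Y'` valued in `{0,1}`,
`P(Y=0) = α`, `P(Y'=0) = β` and `H(X|Y) = H(X'|Y') = c < ∞`, one has
`H(X+X'|Y,Y') − c ≥ g(c,c) − min{h₂(α), h₂(β)}`. -/
theorem stmt17 {Ω : Type*} [MeasurableSpace Ω] (μ : Measure Ω) [IsProbabilityMeasure μ]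
    (X Y X' Y' : Ω → ℤ) (hX : Measurable X) (hY : Measurable Y)
    (hX' : Measurable X') (hY' : Measurable Y')
    (hindep : IndepFun (fun ω => (X ω, Y ω)) (fun ω => (X' ω, Y' ω)) μ)
    (hY01 : ∀ ω, Y ω = 0 ∨ Y ω = 1) (hY'01 : ∀ ω, Y' ω = 0 ∨ Y' ω = 1)
    (α β c : ℝ) (hα : pr μ {ω | Y ω = 0} = α) (hβ : pr μ {ω | Y' ω = 0} = β)
    (hc : CondEntIs μ X Y c) (hc' : CondEntIs μ X' Y' c) :
    condEnt μ (fun ω => X ω + X' ω) (fun ω => (Y ω, Y' ω)) - c ≥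
      gNIID c c - min (H2 α) (H2 β) := by
  have hlog := Real.log_pos one_lt_two
  choose p hp ep using fun b => cond_exists μ hX hY b hc.summable
  choose q hq eq using fun b => cond_exists μ hX' hY' b hc'.summable
  have c1 := hc.unique (condEnt_eq μ hY01 (hp 0) (hp 1) (ep 0) (ep 1))
  have c2 := hc'.unique (condEnt_eq μ hY'01 (hq 0) (hq 1) (eq 0) (eq 1))
  have cs := condEnt_sum μ hX hY hX' hY' hindep hY01 hY'01 hp hq ep eq
  simp only [Finset.sum_pair (zero_ne_one (α := ℤ))] at cs
  have hnn : ∀ A : Set Ω, 0 ≤ pr μ A := fun A => ENNReal.toReal_nonneg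
  have tot : ∀ Z : Ω → ℤ, Measurable Z → (∀ ω, Z ω = 0 ∨ Z ω = 1) →
      pr μ {ω | Z ω = 0} + pr μ {ω | Z ω = 1} = 1 := by
    intro Z hZ h01
    have : {ω | Z ω = 1} = {ω | Z ω = 0}ᶜ := by
      ext ω; rcases h01 ω with h | h <;> simp [h]
    rw [this]
    exact probReal_add_probReal_compl (hZ (measurableSet_singleton 0))
  have hw := tot Y hY hY01
  have hv := tot Y' hY' hY'01
  have hw0 := hnn {ω | Y ω = 0}
  have hw1 := hnn {ω | Y ω = 1}
  have hv0 := hnn {ω | Y' ω = 0}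
  have hv1 := hnn {ω | Y' ω = 1}
  rw [hα] at *
  rw [hβ] at *
  set w1 := pr μ {ω | Y ω = 1}
  set v1 := pr μ {ω | Y' ω = 1}
  choose k hk using fun b => exists_max (hp b)
  choose l hl using fun b => exists_max (hq b)
  have P := fun b b' => pair (hp b) (hq b') (k b) (l b') (hk b) (hl b')
  have hx : ∀ b, p b (k b) ∈ Set.Icc (0:ℝ) 1 := fun b => ⟨(hp b).nn _, (hp b).le_one _⟩
  have hy : ∀ b, q b (l b) ∈ Set.Icc (0:ℝ) 1 := fun b => ⟨(hq b).nn _, (hq b).le_one _⟩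
  have Pa := avg4 hw0 hw1 hv0 hv1 (P 0 0).1 (P 0 1).1 (P 1 0).1 (P 1 1).1
  have Pb := avg4 hw0 hw1 hv0 hv1 (P 0 0).2.1 (P 0 1).2.1 (P 1 0).2.1 (P 1 1).2.1
  have Pc := avg4 hw0 hw1 hv0 hv1 (P 0 0).2.2 (P 0 1).2.2 (P 1 0).2.2 (P 1 1).2.2
  have hx0 := hx 0
  have hx1 := hx 1
  have hy0 := hy 0
  have hy1 := hy 1
  generalize p 0 (k 0) = x0 at *
  generalize p 1 (k 1) = x1 at *
  generalize q 0 (l 0) = y0 at *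
  generalize q 1 (l 1) = y1 at *
  generalize ent (conv (p 0) (q 0)) = H00 at *
  generalize ent (conv (p 0) (q 1)) = H01 at *
  generalize ent (conv (p 1) (q 0)) = H10 at *
  generalize ent (conv (p 1) (q 1)) = H11 at *
  generalize ent (p 0) = C0 at *
  generalize ent (p 1) = C1 at *
  generalize ent (q 0) = D0 at *
  generalize ent (q 1) = D1 at *
  clear_value w1 v1
  clear P hk hl ep eq hc hc' hindep
  rw [cs]
  have hbin : 0 ≤ min (H2 α) (H2 β) := by
    rw [H2_eq, H2_eq]
    exact le_min (div_nonneg (Real.binEntropy_nonneg hw0 (by linarith)) hlog.le)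
      (div_nonneg (Real.binEntropy_nonneg hv0 (by linarith)) hlog.le)
  obtain rfl : w1 = 1 - α := by linarith
  obtain rfl : v1 = 1 - β := by linarith
  have c1' : α * C0 + (1 - α) * C1 = c * Real.log 2 := by rw [c1]; field_simp
  have c2' : β * D0 + (1 - β) * D1 = c * Real.log 2 := by rw [c2]; field_simp
  set K := α * β * (2 * H00 - C0 - D0) + α * (1 - β) * (2 * H01 - C0 - D1) +
    (1 - α) * β * (2 * H10 - C1 - D0) + (1 - α) * (1 - β) * (2 * H11 - C1 - D1) with hK
  have xb := (convex_Icc (0:ℝ) 1) hx0 hx1 hw0 hw1 hw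
  have yb := (convex_Icc (0:ℝ) 1) hy0 hy1 hv0 hv1 hv
  simp only [smul_eq_mul] at xb yb
  have cx := conc hw0 hw1 hw hx0 hx1
  have cy := conc hv0 hv1 hv hy0 hy1
  have sx := var2 x0 x1 hw0 hw1 hw
  have sy := var2 y0 y1 hv0 hv1 hv
  have sx' := var2 (1 - x0) (1 - x1) hw0 hw1 hw
  have sy' := var2 (1 - y0) (1 - y1) hv0 hv1 hv
  have ex : α * (1 - x0) + (1 - α) * (1 - x1) = 1 - (α * x0 + (1 - α) * x1) := by ring
  have ey : β * (1 - y0) + (1 - β) * (1 - y1) = 1 - (β * y0 + (1 - β) * y1) := by ring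
  rw [ex] at sx'
  rw [ey] at sy'
  set x := α * x0 + (1 - α) * x1 with hxd
  set y := β * y0 + (1 - β) * y1 with hyd
  have hg : gNIID c c ≤ (1 / 2) * (K / Real.log 2) := by
    refine g_le xb.1 xb.2 yb.1 yb.2 ?_ ?_
    · rw [H2_eq, H2_eq, le_div_iff₀ hlog]
      have e : (c * x - Real.binEntropy x / Real.log 2 + c * y - Real.binEntropy y / Real.log 2) * Real.log 2
        = (c * Real.log 2) * x - Real.binEntropy x + (c * Real.log 2) * y - Real.binEntropy y := by
        field_simp
      rw [e]
      have e1 : (c * Real.log 2) * x = (β * D0 + (1 - β) * D1) * (α * x0 + (1 - α) * x1) := by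
        rw [c2', hxd]
      have e2 : (c * Real.log 2) * y = (α * C0 + (1 - α) * C1) * (β * y0 + (1 - β) * y1) := by
        rw [c1', hyd]
      rw [e1, e2]
      refine le_trans ?_ Pa
      linarith
    · refine lfun_le xb.1 xb.2 yb.1 yb.2 (le_trans ?_ Pb) (le_trans ?_ Pc)
      · have m1 := mul_le_mul_of_nonneg_right sx' (sub_nonneg.2 yb.2)
        have m2 := mul_le_mul_of_nonneg_right sy' (sub_nonneg.2 xb.2)
        have l1 : (1 - x) * (1 - y) * (1 - x + (1 - y)) / 8 =
          ((1 - x) ^ 2 * (1 - y) + (1 - y) ^ 2 * (1 - x)) / 8 := by ring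
        rw [l1]
        refine (div_le_div_of_nonneg_right (add_le_add m1 m2) (by norm_num)).trans (le_of_eq ?_)
        rw [hxd, hyd]; ring
      · have m1 := mul_le_mul_of_nonneg_left sy (sub_nonneg.2 xb.2)
        have m2 := mul_le_mul_of_nonneg_left sx (sub_nonneg.2 yb.2)
        have l1 : (1 - x) * y ^ 2 / 2 + (1 - y) * x ^ 2 / 2 =
          ((1 - x) * y ^ 2 + (1 - y) * x ^ 2) / 2 := by ring
        rw [l1]
        refine (div_le_div_of_nonneg_right (add_le_add m1 m2) (by norm_num)).trans (le_of_eq ?_)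
        rw [hxd, hyd]; ring
  have hfin : (1 / 2) * (K / Real.log 2) = α * β * H00 / Real.log 2 + α * (1 - β) * H01 / Real.log 2 +
      ((1 - α) * β * H10 / Real.log 2 + (1 - α) * (1 - β) * H11 / Real.log 2) - c := by
    have : K = 2 * (α * β * H00 + α * (1 - β) * H01 + (1 - α) * β * H10 + (1 - α) * (1 - β) * H11)
        - (α * C0 + (1 - α) * C1) - (β * D0 + (1 - β) * D1) := by rw [hK]; ring
    rw [this, c1', c2']
    field_simp
    ring
  linarith
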